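/- Consider an admissible length-k trajectory model (G, A, D, M_0, z_0,…,z_{k−1}, f_0,…,f_{k−1}, M_1,…,M_k) with k ≥ 1. Then for every 0 ≤ j ≤ k−1: (a) H(M_{j+1} | M_j) = H( f_j(M_j, D) | M_j ) + H(z_j), and (b) H(M_{j+1} | (D, M_j)) = H(z_j). -/

import Mathlib

open MeasureTheory ProbabilityTheory

/-- Shannon entropy of a finite-valued random variable `X` under measure `μ`:
`H(X) = ∑ x, −P(X = x) · log P(X = x)`. -/
noncomputable def entropy {Ω S : Type*} [MeasurableSpace Ω] [Fintype S]
    (μ : Measure Ω) (X : Ω → S) : ℝ :=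
  ∑ x : S, Real.negMulLog (μ (X ⁻¹' {x})).toReal

/-- Conditional entropy `H(X | Y) = ∑ y, P(Y = y) · H(X | Y = y)`, where the inner
entropy is taken under the conditional probability measure given `{Y = y}`. -/
noncomputable def condEntropy {Ω S T : Type*} [MeasurableSpace Ω] [Fintype S] [Fintype T]
    (μ : Measure Ω) (X : Ω → S) (Y : Ω → T) : ℝ :=
  ∑ y : T, (μ (Y ⁻¹' {y})).toReal * entropy (μ[|Y ⁻¹' {y}]) X

/-- Mutual information `I(X ; Y) = H(X) − H(X | Y)`. -/
noncomputable def mutualInfo {Ω S T : Type*} [MeasurableSpace Ω] [Fintype S] [Fintype T]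
    (μ : Measure Ω) (X : Ω → S) (Y : Ω → T) : ℝ :=
  entropy μ X - condEntropy μ X Y

/-- `X` is conditionally independent of `W` given `Y`: for every value `y` of `Y` with
positive probability, the conditional joint pmf of `(X, W)` given `{Y = y}` factorizes
into the product of the conditional marginals. -/
def CondIndepFun {Ω S U T : Type*} [MeasurableSpace Ω]
    (μ : Measure Ω) (X : Ω → S) (W : Ω → U) (Y : Ω → T) : Prop :=
  ∀ y : T, 0 < μ (Y ⁻¹' {y}) → ∀ (x : S) (w : U),
    (μ[|Y ⁻¹' {y}]) (X ⁻¹' {x} ∩ W ⁻¹' {w}) =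
      (μ[|Y ⁻¹' {y}]) (X ⁻¹' {x}) * (μ[|Y ⁻¹' {y}]) (W ⁻¹' {w})

/-- An admissible length-`k` trajectory model: data `D`, model states `M_0, …, M_k` in a
finite additive commutative group `G`, noises `Z_0, …, Z_{k−1}` and update functions
`f_0, …, f_{k−1}` such that
(0) `M_{j+1} = f_j (M_j, D) + Z_j` for `0 ≤ j ≤ k−1`;
(i) the family `{D, M_0, Z_0, …, Z_{k−1}}` is mutually independent (stated via the
    joint-pmf factorization, which characterizes mutual independence for finite-valued
    random variables);
(ii) for each `1 ≤ j ≤ k−1`, `M_{j+1}` is conditionally independent of `(M_0,…,M_{j−1})`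
    given `M_j`, and also given `(D, M_j)`;
(iii) for each `0 ≤ j ≤ k−1` and each `m` with `P(M_j = m) > 0`, the addition map is
    injective on the product of the support of `f_j(M_j, D)` jointly with `{M_j = m}`
    and the support of `Z_j`. -/
def Admissible {Ω G A : Type*} [MeasurableSpace Ω] [AddCommGroup G]
    (μ : MeasureTheory.Measure Ω) (k : ℕ) (D : Ω → A) (M : ℕ → Ω → G) (Z : ℕ → Ω → G)
    (f : ℕ → G × A → G) : Prop :=
  (∀ j < k, ∀ ω, M (j + 1) ω = f j (M j ω, D ω) + Z j ω) ∧
  (∀ (a : A) (m0 : G) (zs : Fin k → G),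
      μ (D ⁻¹' {a} ∩ M 0 ⁻¹' {m0} ∩ ⋂ j : Fin k, Z j.val ⁻¹' {zs j}) =
        μ (D ⁻¹' {a}) * μ (M 0 ⁻¹' {m0}) * ∏ j : Fin k, μ (Z j.val ⁻¹' {zs j})) ∧
  (∀ j, 1 ≤ j → j < k →
      CondIndepFun μ (M (j + 1)) (fun ω (i : Fin j) => M i.val ω) (M j) ∧
      CondIndepFun μ (M (j + 1)) (fun ω (i : Fin j) => M i.val ω)
        (fun ω => (D ω, M j ω))) ∧
  (∀ j < k, ∀ m : G, 0 < μ (M j ⁻¹' {m}) →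
      Set.InjOn (fun p : G × G => p.1 + p.2)
        ({x : G | 0 < μ ((fun ω => f j (M j ω, D ω)) ⁻¹' {x} ∩ M j ⁻¹' {m})} ×ˢ
          {zv : G | 0 < μ (Z j ⁻¹' {zv})}))

/-- Entropy depends only on the law of the random variable. -/
lemma entropy_eq_of_measure_preimage_eq {Ω Ω' S : Type*} [MeasurableSpace Ω] [MeasurableSpace Ω']
    [Fintype S] {μ : Measure Ω} {ν : Measure Ω'} {X : Ω → S} {Y : Ω' → S}
    (h : ∀ x, μ (X ⁻¹' {x}) = ν (Y ⁻¹' {x})) : entropy μ X = entropy ν Y := by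
  simp only [entropy, h]

lemma entropy_congr_ae {Ω S : Type*} [MeasurableSpace Ω] [Fintype S] {μ : Measure Ω}
    {X Y : Ω → S} (h : X =ᵐ[μ] Y) : entropy μ X = entropy μ Y :=
  entropy_eq_of_measure_preimage_eq fun x ↦ measure_congr <| by
    filter_upwards [h] with ω hω
    change (X ω = x) = (Y ω = x)
    rw [hω]

/-- Entropy is invariant under maps that are injective on the support. -/
lemma entropy_comp_of_injOn {Ω S T : Type*} [MeasurableSpace Ω] [Fintype S] [Fintype T]
    [MeasurableSpace S] [DiscreteMeasurableSpace S]
    {μ : Measure Ω} [IsFiniteMeasure μ] {X : Ω → S} (hX : Measurable X) {φ : S → T}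
    (hφ : Set.InjOn φ {x | 0 < μ (X ⁻¹' {x})}) :
    entropy μ (φ ∘ X) = entropy μ X := by
  classical
  have hfiber (t : T) : μ ((φ ∘ X) ⁻¹' {t}) = ∑ x with φ x = t, μ (X ⁻¹' {x}) := by
    rw [sum_measure_preimage_singleton _ fun x _ ↦ hX (measurableSet_singleton x)]
    congr 1
    ext ω
    simp
  unfold entropy
  rw [← Finset.sum_fiberwise Finset.univ φ]
  refine Finset.sum_congr rfl fun t _ ↦ ?_
  rw [hfiber]
  by_cases h : ∃ x, φ x = t ∧ 0 < μ (X ⁻¹' {x})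
  · obtain ⟨x, hxt, hx⟩ := h
    have hz : ∀ y ∈ Finset.univ.filter (φ · = t), y ≠ x → μ (X ⁻¹' {y}) = 0 := by
      intro y hy hyx
      by_contra h0
      exact hyx (hφ (pos_iff_ne_zero.2 h0) hx (by simp_all))
    have hmem : x ∈ Finset.univ.filter (φ · = t) := by simp [hxt]
    rw [Finset.sum_eq_single_of_mem x hmem hz, Finset.sum_eq_single_of_mem x hmem]
    intro y hy hyx
    simp [hz y hy hyx]
  · have hz : ∀ y ∈ Finset.univ.filter (φ · = t), μ (X ⁻¹' {y}) = 0 := by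
      intro y hy
      by_contra h0
      exact h ⟨y, by simpa using hy, pos_iff_ne_zero.2 h0⟩
    rw [Finset.sum_eq_zero hz, Finset.sum_eq_zero]
    · simp
    · intro y hy
      simp [hz y hy]

lemma sum_toReal_measure_preimage_singleton {Ω S : Type*} [MeasurableSpace Ω] [Fintype S]
    [MeasurableSpace S] [DiscreteMeasurableSpace S]
    {μ : Measure Ω} [IsProbabilityMeasure μ] {X : Ω → S} (hX : Measurable X) :
    ∑ x, (μ (X ⁻¹' {x})).toReal = 1 := by
  rw [← ENNReal.toReal_sum (by simp),
    sum_measure_preimage_singleton _ fun x _ ↦ hX (measurableSet_singleton x)]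
  simp

/-- Entropy is additive over pairs of independent random variables. -/
lemma entropy_prodMk_of_indepFun {Ω S T : Type*} [MeasurableSpace Ω] [Fintype S] [Fintype T]
    [MeasurableSpace S] [DiscreteMeasurableSpace S] [MeasurableSpace T] [DiscreteMeasurableSpace T]
    {μ : Measure Ω} [IsProbabilityMeasure μ] {X : Ω → S} {Y : Ω → T}
    (hX : Measurable X) (hY : Measurable Y) (h : IndepFun X Y μ) :
    entropy μ (fun ω ↦ (X ω, Y ω)) = entropy μ X + entropy μ Y := by
  have hp (x : S) (y : T) : (μ ((fun ω ↦ (X ω, Y ω)) ⁻¹' {(x, y)})).toReal =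
      (μ (X ⁻¹' {x})).toReal * (μ (Y ⁻¹' {y})).toReal := by
    rw [← ENNReal.toReal_mul, ← h.measure_inter_preimage_eq_mul _ _ (measurableSet_singleton x)
      (measurableSet_singleton y)]
    congr 2
    ext ω
    simp
  unfold entropy
  simp only [Fintype.sum_prod_type, hp, Real.negMulLog_mul, Finset.sum_add_distrib]
  simp only [← Finset.mul_sum, ← Finset.sum_mul, sum_toReal_measure_preimage_singleton hX,
    sum_toReal_measure_preimage_singleton hY, one_mul]

lemma cond_preimage_of_indepFun {Ω S T : Type*} [MeasurableSpace Ω] [MeasurableSpace S]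
    [MeasurableSpace T] {μ : Measure Ω} [IsFiniteMeasure μ] {U : Ω → S} {Z : Ω → T}
    (hU : Measurable U) (h : IndepFun U Z μ) {E : Set S} (hE : MeasurableSet E)
    (h0 : μ (U ⁻¹' E) ≠ 0) {C : Set T} (hC : MeasurableSet C) :
    μ[|U ⁻¹' E] (Z ⁻¹' C) = μ (Z ⁻¹' C) := by
  rw [cond_apply (hU hE), h.measure_inter_preimage_eq_mul _ _ hE hC, ← mul_assoc,
    ENNReal.inv_mul_cancel h0 (measure_ne_top _ _), one_mul]

/-- Independence of `U` and `Z` survives conditioning on an event determined by `U`. -/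
lemma indepFun_cond_preimage {Ω S T : Type*} [MeasurableSpace Ω] [MeasurableSpace S]
    [MeasurableSpace T] {μ : Measure Ω} [IsFiniteMeasure μ] {U : Ω → S} {Z : Ω → T}
    (hU : Measurable U) (h : IndepFun U Z μ) {E : Set S} (hE : MeasurableSet E)
    (h0 : μ (U ⁻¹' E) ≠ 0) : IndepFun U Z μ[|U ⁻¹' E] := by
  rw [indepFun_iff_measure_inter_preimage_eq_mul]
  intro B C hB hC
  rw [cond_preimage_of_indepFun hU h hE h0 hC, cond_apply (hU hE), cond_apply (hU hE),
    ← Set.inter_assoc, ← Set.preimage_inter, h.measure_inter_preimage_eq_mul _ _ (hE.inter hB) hC,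
    mul_assoc]

lemma indepFun_prodMk_left_of_indepFun_prodMk_right {Ω R S T : Type*} [MeasurableSpace Ω]
    [MeasurableSpace R] [MeasurableSpace S] [MeasurableSpace T]
    {μ : Measure Ω} [IsProbabilityMeasure μ] {W : Ω → R} {V : Ω → S} {Z : Ω → T}
    (hW : Measurable W) (hV : Measurable V) (hZ : Measurable Z)
    (h : IndepFun W (fun ω ↦ (V ω, Z ω)) μ) (hVZ : IndepFun V Z μ) :
    IndepFun (fun ω ↦ (W ω, V ω)) Z μ := by
  have := Measure.isProbabilityMeasure_map (μ := μ) hW.aemeasurable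
  have := Measure.isProbabilityMeasure_map (μ := μ) hV.aemeasurable
  have := Measure.isProbabilityMeasure_map (μ := μ) hZ.aemeasurable
  have hWV : IndepFun W V μ := h.comp measurable_id measurable_fst
  rw [indepFun_iff_map_prod_eq_prod_map_map (by fun_prop) (by fun_prop)] at h hVZ hWV ⊢
  rw [hWV, ← (measurePreserving_prodAssoc (μ.map W) (μ.map V) (μ.map Z)).symm.map_eq, ← hVZ, ← h,
    Measure.map_map (by fun_prop) (by fun_prop)]
  rfl

/-- If the joint law of `D`, `M₀` and a finite family `Z` factorizes on singletons, then
`(D, M₀)` together with the noises outside `i` is independent of `Z i`. -/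
lemma indepFun_history_of_measure_inter_eq_mul {Ω G A ι : Type*} [MeasurableSpace Ω]
    {μ : Measure Ω} [IsProbabilityMeasure μ] [Fintype ι] [Fintype G] [Fintype A]
    [MeasurableSpace G] [DiscreteMeasurableSpace G] [MeasurableSpace A] [DiscreteMeasurableSpace A]
    {D : Ω → A} {M₀ : Ω → G} {Z : ι → Ω → G}
    (hD : Measurable D) (hM₀ : Measurable M₀) (hZ : ∀ i, Measurable (Z i))
    (h : ∀ (a : A) (m : G) (zs : ι → G),
      μ (D ⁻¹' {a} ∩ M₀ ⁻¹' {m} ∩ ⋂ i, Z i ⁻¹' {zs i}) =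
        μ (D ⁻¹' {a}) * μ (M₀ ⁻¹' {m}) * ∏ i, μ (Z i ⁻¹' {zs i}))
    {i : ι} {s : Finset ι} (hi : i ∉ s) :
    IndepFun (fun ω ↦ ((D ω, M₀ ω), fun l : s ↦ Z l ω)) (Z i) μ := by
  have := Measure.isProbabilityMeasure_map (μ := μ) hD.aemeasurable
  have := Measure.isProbabilityMeasure_map (μ := μ) hM₀.aemeasurable
  have := fun i ↦ Measure.isProbabilityMeasure_map (μ := μ) (hZ i).aemeasurable
  have hW : Measurable fun ω ↦ (D ω, M₀ ω) := by fun_prop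
  have hV : Measurable fun ω i ↦ Z i ω := by fun_prop
  have hlaw : μ.map (fun ω ↦ ((D ω, M₀ ω), fun i ↦ Z i ω)) =
      ((μ.map D).prod (μ.map M₀)).prod (Measure.pi fun i ↦ μ.map (Z i)) := by
    refine Measure.ext_of_singleton fun ⟨⟨a, m⟩, zs⟩ ↦ ?_
    rw [Measure.map_apply (by fun_prop) (measurableSet_singleton _), ← Set.singleton_prod_singleton,
      ← Set.singleton_prod_singleton, Measure.prod_prod, Measure.prod_prod, Measure.pi_singleton,
      Measure.map_apply hD (measurableSet_singleton _),
      Measure.map_apply hM₀ (measurableSet_singleton _)]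
    simp only [Measure.map_apply (hZ _) (measurableSet_singleton _)]
    rw [← h]
    congr 1
    ext ω
    simp [funext_iff]
  have hlawV : μ.map (fun ω i ↦ Z i ω) = Measure.pi fun i ↦ μ.map (Z i) := by
    have := congrArg Measure.snd hlaw
    rwa [Measure.snd_prod, Measure.snd_map_prodMk hW] at this
  have hlawW : μ.map (fun ω ↦ (D ω, M₀ ω)) = (μ.map D).prod (μ.map M₀) := by
    have := congrArg Measure.fst hlaw
    rwa [Measure.fst_prod, Measure.fst_map_prodMk hV] at this
  have hWV : IndepFun (fun ω ↦ (D ω, M₀ ω)) (fun ω i ↦ Z i ω) μ := by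
    rw [indepFun_iff_map_prod_eq_prod_map_map hW.aemeasurable hV.aemeasurable, hlaw, hlawV, hlawW]
  have hZindep : iIndepFun Z μ := by
    rwa [iIndepFun_iff_map_fun_eq_pi_map fun i ↦ (hZ i).aemeasurable]
  refine indepFun_prodMk_left_of_indepFun_prodMk_right hW (by fun_prop) (hZ i)
    (hWV.comp (ψ := fun z : ι → G ↦ ((fun l : s ↦ z l.1), z i)) measurable_id (by fun_prop)) ?_
  exact (hZindep.indepFun_finset s {i} (by simpa using hi) hZ).comp measurable_id
    (measurable_pi_apply (⟨i, by simp⟩ : ({i} : Finset ι)))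

/-- In a trajectory driven by `M_{j+1} = f_j (M_j, D) + Z_j`, the state `M_j` is a function of
`D`, `M_0` and the noises `Z_i` with `i < j`. -/
lemma exists_eq_comp_history {Ω G A : Type*} [Add G] {k : ℕ} {D : Ω → A} {M Z : ℕ → Ω → G}
    {f : ℕ → G × A → G} (h : ∀ j < k, ∀ ω, M (j + 1) ω = f j (M j ω, D ω) + Z j ω)
    {s : Finset (Fin k)} {j : ℕ} (hj : j ≤ k) (hs : ∀ i : Fin k, i.val < j → i ∈ s) :
    ∃ g : (A × G) × (s → G) → G, ∀ ω, M j ω = g ((D ω, M 0 ω), fun l : s ↦ Z l.1 ω) := by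
  induction j with
  | zero => exact ⟨fun x ↦ x.1.2, fun _ ↦ rfl⟩
  | succ j ih =>
    obtain ⟨g, hg⟩ := ih (by omega) fun i hi ↦ hs i (by omega)
    refine ⟨fun x ↦ f j (g x, x.1.1) + x.2 ⟨⟨j, by omega⟩, hs _ (by simp)⟩, fun ω ↦ ?_⟩
    rw [h j (by omega), hg]

/-- The noise `Z_j` is independent of the pair `(D, M_j)`. -/
lemma Admissible.indepFun_noise {Ω G A : Type*} [MeasurableSpace Ω] {μ : Measure Ω}
    [IsProbabilityMeasure μ] [Fintype G] [AddCommGroup G]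
    [MeasurableSpace G] [DiscreteMeasurableSpace G]
    [Fintype A] [MeasurableSpace A] [DiscreteMeasurableSpace A]
    {k : ℕ} {D : Ω → A} {M Z : ℕ → Ω → G} {f : ℕ → G × A → G}
    (hAdm : Admissible μ k D M Z f)
    (hD : Measurable D) (hM : ∀ j, Measurable (M j)) (hZ : ∀ j, Measurable (Z j))
    {j : ℕ} (hj : j < k) :
    IndepFun (fun ω ↦ (D ω, M j ω)) (Z j) μ := by
  obtain ⟨hstep, hlaw, -, -⟩ := hAdm
  let s : Finset (Fin k) := {i | i.val < j}
  obtain ⟨g, hg⟩ := exists_eq_comp_history hstep (s := s) hj.le (by simp [s])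
  have hind := indepFun_history_of_measure_inter_eq_mul hD (hM 0) (fun i : Fin k ↦ hZ i) hlaw
    (i := ⟨j, hj⟩) (s := s) (by simp [s])
  simp only [hg]
  exact hind.comp (φ := fun x ↦ (x.1.1, g x)) (.of_discrete) measurable_id

/-- For an admissible length-`k` trajectory model (`k ≥ 1`), for every `0 ≤ j ≤ k−1`:
(a) `H(M_{j+1} | M_j) = H(f_j(M_j, D) | M_j) + H(Z_j)`, and
(b) `H(M_{j+1} | (D, M_j)) = H(Z_j)`. -/
theorem condEntropy_step_of_admissible
    {Ω : Type*} [MeasurableSpace Ω] (μ : Measure Ω) [IsProbabilityMeasure μ]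
    {G : Type*} [Fintype G] [AddCommGroup G]
    [MeasurableSpace G] [DiscreteMeasurableSpace G]
    {A : Type*} [Fintype A] [MeasurableSpace A] [DiscreteMeasurableSpace A]
    {k : ℕ} (hk : 1 ≤ k)
    (D : Ω → A) (M Z : ℕ → Ω → G) (f : ℕ → G × A → G)
    (hD : Measurable D) (hM : ∀ j, Measurable (M j)) (hZ : ∀ j, Measurable (Z j))
    (hAdm : Admissible μ k D M Z f) :
    ∀ j < k,
      condEntropy μ (M (j + 1)) (M j) =
          condEntropy μ (fun ω => f j (M j ω, D ω)) (M j) + entropy μ (Z j) ∧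
        condEntropy μ (M (j + 1)) (fun ω => (D ω, M j ω)) = entropy μ (Z j) := by
  intro j hj
  have hind := hAdm.indepFun_noise hD hM hZ hj
  obtain ⟨hstep, -, -, hinj⟩ := hAdm
  have hU : Measurable fun ω ↦ (D ω, M j ω) := hD.prodMk (hM j)
  have hX : Measurable fun ω ↦ f j (M j ω, D ω) :=
    (Measurable.of_discrete (f := f j)).comp ((hM j).prodMk hD)
  constructor
  · have hterm (m : G) : (μ (M j ⁻¹' {m})).toReal * entropy (μ[|M j ⁻¹' {m}]) (M (j + 1)) =
        (μ (M j ⁻¹' {m})).toReal * entropy (μ[|M j ⁻¹' {m}]) (fun ω ↦ f j (M j ω, D ω)) +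
          (μ (M j ⁻¹' {m})).toReal * entropy μ (Z j) := by
      rcases eq_or_ne (μ (M j ⁻¹' {m})) 0 with h0 | h0
      · simp [h0]
      rw [← mul_add]
      congr 1
      have := cond_isProbabilityMeasure h0
      have hE : MeasurableSet (Prod.snd ⁻¹' {m} : Set (A × G)) := .of_discrete
      have hnoise (C : Set G) : μ[|M j ⁻¹' {m}] (Z j ⁻¹' C) = μ (Z j ⁻¹' C) :=
        cond_preimage_of_indepFun hU hind hE h0 .of_discrete
      have hXZ : IndepFun (fun ω ↦ f j (M j ω, D ω)) (Z j) μ[|M j ⁻¹' {m}] :=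
        (indepFun_cond_preimage hU hind hE h0).comp
          (φ := fun x : A × G ↦ f j (x.2, x.1))
          .of_discrete measurable_id
      have hsum : M (j + 1) =
          (fun p : G × G ↦ p.1 + p.2) ∘ fun ω ↦ (f j (M j ω, D ω), Z j ω) :=
        funext (hstep j hj)
      rw [hsum, entropy_comp_of_injOn (hX.prodMk (hZ j)), entropy_prodMk_of_indepFun hX (hZ j) hXZ,
        entropy_eq_of_measure_preimage_eq fun z ↦ hnoise {z}]
      refine (hinj j hj m (pos_iff_ne_zero.2 h0)).mono fun p hp ↦ Set.mem_prod.2 ⟨?_, ?_⟩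
      · have hpos : 0 < μ[|M j ⁻¹' {m}] ((fun ω ↦ f j (M j ω, D ω)) ⁻¹' {p.1}) :=
          lt_of_lt_of_le hp (measure_mono fun ω hω ↦ congrArg Prod.fst hω)
        rw [cond_apply (hM j (measurableSet_singleton m)), Set.inter_comm] at hpos
        exact pos_iff_ne_zero.2 (right_ne_zero_of_mul hpos.ne')
      · rw [Set.mem_ofPred_eq, ← hnoise]
        exact lt_of_lt_of_le hp (measure_mono fun ω hω ↦ congrArg Prod.snd hω)
    unfold condEntropy
    simp only [hterm, Finset.sum_add_distrib, ← Finset.sum_mul,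
      sum_toReal_measure_preimage_singleton (hM j), one_mul]
  · have hterm (u : A × G) : (μ ((fun ω ↦ (D ω, M j ω)) ⁻¹' {u})).toReal *
        entropy (μ[|(fun ω ↦ (D ω, M j ω)) ⁻¹' {u}]) (M (j + 1)) =
          (μ ((fun ω ↦ (D ω, M j ω)) ⁻¹' {u})).toReal * entropy μ (Z j) := by
      rcases eq_or_ne (μ ((fun ω ↦ (D ω, M j ω)) ⁻¹' {u})) 0 with h0 | h0
      · simp [h0]
      congr 1
      have hu := measurableSet_singleton u
      have hae : M (j + 1) =ᵐ[μ[|(fun ω ↦ (D ω, M j ω)) ⁻¹' {u}]]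
          (fun z ↦ f j (u.2, u.1) + z) ∘ Z j := by
        filter_upwards [ae_cond_mem (hU hu)] with ω hω
        rw [Set.mem_preimage, Set.mem_singleton_iff] at hω
        simp [hstep j hj, ← hω]
      rw [entropy_congr_ae hae, entropy_comp_of_injOn (hZ j) (add_right_injective _).injOn]
      exact entropy_eq_of_measure_preimage_eq fun z ↦
        cond_preimage_of_indepFun hU hind hu h0 (measurableSet_singleton z)
    unfold condEntropy
    simp only [hterm, ← Finset.sum_mul, sum_toReal_measure_preimage_singleton hU, one_mul]
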